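/- In a finite sequential game in which every player has an acyclic preference relation, the lazy improvement relation ⇀ is a semi-potential: ⇀ is acyclic, ⇀ is contained in the improvement relation ↠, and whenever s ↠ s' there exists s'' with s ⇀ s'' and v(s') = v(s''). -/

import Mathlib

/-- A finite sequential game: a finite rooted tree whose internal vertices are owned by
players and whose leaves carry outcomes. -/
inductive GameTree (A O : Type) : Type where
  | leaf : O → GameTree A O
  | node : A → (n : ℕ) → (Fin (n+1) → GameTree A O) → GameTree A O

/-- A strategy profile of a finite sequential game: the game tree together with
one chosen child at each internal vertex. -/
inductive Profile (A O : Type) : Type where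
  | leaf : O → Profile A O
  | node : A → (n : ℕ) → (Fin (n+1) → Profile A O) → Fin (n+1) → Profile A O

namespace Profile

/-- The outcome induced by a strategy profile. -/
def outcome {A O : Type} : Profile A O → O
  | leaf o => o
  | node _ _ c i => outcome (c i)

/-- The play (maximal path from the root, given by the indices of the chosen children)
induced by a strategy profile. -/
def play {A O : Type} : Profile A O → List ℕ
  | leaf _ => []
  | node _ _ c i => i.1 :: play (c i)

/-- The game underlying a strategy profile. -/
def s2g {A O : Type} : Profile A O → GameTree A O
  | leaf o => .leaf o
  | node p n c _ => .node p n (fun j => s2g (c j))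

/-- Player `a` can lazily convert `s` into `s'` (`s ⇀ᶜ_a s'`): every vertex at which `s`
and `s'` differ is owned by `a` and lies on the play induced by `s'`. -/
inductive LazyConv {A O : Type} (a : A) : Profile A O → Profile A O → Prop where
  | leaf (o : O) : LazyConv a (.leaf o) (.leaf o)
  | node (p : A) (n : ℕ) (c c' : Fin (n+1) → Profile A O) (i i' : Fin (n+1)) :
      (i ≠ i' → p = a) →
      (∀ j, j ≠ i' → c j = c' j) →
      LazyConv a (c i') (c' i') →
      LazyConv a (.node p n c i) (.node p n c' i')

/-- Player `a` can convert `s` into `s'` (`s ↠ᶜ_a s'`): every vertex at which `s` and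
`s'` differ is owned by `a`. -/
inductive Conv {A O : Type} (a : A) : Profile A O → Profile A O → Prop where
  | leaf (o : O) : Conv a (.leaf o) (.leaf o)
  | node (p : A) (n : ℕ) (c c' : Fin (n+1) → Profile A O) (i i' : Fin (n+1)) :
      (i ≠ i' → p = a) →
      (∀ j, Conv a (c j) (c' j)) →
      Conv a (.node p n c i) (.node p n c' i')

/-- The lazy improvement relation of player `a` (`⇀_a`). -/
def LazyImp {A O : Type} (prec : A → O → O → Prop) (a : A) (s s' : Profile A O) : Prop :=
  LazyConv a s s' ∧ prec a s.outcome s'.outcome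

/-- The collective lazy improvement relation (`⇀`). -/
def Lazy {A O : Type} (prec : A → O → O → Prop) (s s' : Profile A O) : Prop :=
  ∃ a, LazyImp prec a s s'

/-- The improvement relation of player `a` (`↠_a`). -/
def Imp {A O : Type} (prec : A → O → O → Prop) (a : A) (s s' : Profile A O) : Prop :=
  Conv a s s' ∧ prec a s.outcome s'.outcome

/-- The collective improvement relation (`↠`). -/
def Improve {A O : Type} (prec : A → O → O → Prop) (s s' : Profile A O) : Prop :=
  ∃ a, Imp prec a s s'

end Profile

/-- A relation is acyclic if it admits no finite cycle `x₀ ≺ x₁ ≺ … ≺ x_k ≺ x₀`. -/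
def Acyclic {X : Type*} (r : X → X → Prop) : Prop :=
  ∀ x, ¬ Relation.TransGen r x x

namespace Profile

open Classical in
/-- A potential for player `q` and weight `f`. -/
noncomputable def pot {A O : Type} (q : A) (f : O → ℤ) : Profile A O → ℤ
  | leaf _ => 0
  | node p _ c i =>
      if p = q then (∑ j, (pot q f (c j) - f (outcome (c j)))) + f (outcome (c i))
      else ∑ j, pot q f (c j)

theorem sum_change {n : ℕ} (g g' : Fin n → ℤ) (i : Fin n) (h : ∀ j, j ≠ i → g j = g' j) :
    (∑ j, g' j) - ∑ j, g j = g' i - g i := by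
  rw [← Finset.sum_sub_distrib]
  apply Finset.sum_eq_single i
  · intro j _ hj
    rw [h j hj, sub_self]
  · intro h
    exact absurd (Finset.mem_univ i) h

open Classical in
theorem pot_step {A O : Type} (q : A) (f : O → ℤ) (a : A) {s s' : Profile A O}
    (h : LazyConv a s s') :
    pot q f s' - pot q f s = if a = q then f s'.outcome - f s.outcome else 0 := by
  induction h with
  | leaf o => simp
  | node p n c c' i i' hp hc _ ih =>
    have e1 := sum_change (fun j => pot q f (c j)) (fun j => pot q f (c' j)) i'
      (fun j hj => by simp only [hc j hj])
    have e2 := sum_change (fun j => pot q f (c j) - f (outcome (c j)))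
      (fun j => pot q f (c' j) - f (outcome (c' j))) i' (fun j hj => by simp only [hc j hj])
    simp only [pot, outcome]
    by_cases hi : i = i'
    · subst hi
      split_ifs at * <;> linarith
    · have := hp hi
      subst this
      split_ifs at * <;> linarith

theorem conv_refl {A O : Type} (a : A) (s : Profile A O) : Conv a s s := by
  induction s with
  | leaf o => exact .leaf o
  | node p n c i ih => exact .node p n c c i i (fun h => absurd rfl h) ih

theorem LazyConv.conv {A O : Type} {a : A} {s s' : Profile A O} (h : LazyConv a s s') :
    Conv a s s' := by
  induction h with
  | leaf o => exact .leaf o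
  | node p n c c' i i' hp hc _ ih =>
    refine .node p n c c' i i' hp (fun j => ?_)
    by_cases hj : j = i'
    · subst hj; exact ih
    · rw [hc j hj]; exact conv_refl a _

theorem Conv.lazify {A O : Type} {a : A} {s s' : Profile A O} (h : Conv a s s') :
    ∃ s'', LazyConv a s s'' ∧ outcome s'' = outcome s' := by
  induction h with
  | leaf o => exact ⟨_, .leaf o, rfl⟩
  | node p n c c' i i' hp _ ih =>
    obtain ⟨t, ht, ho⟩ := ih i'
    refine ⟨.node p n (Function.update c i' t) i', .node p n c _ i i' hp ?_ ?_, ?_⟩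
    · intro j hj
      rw [Function.update_of_ne hj]
    · simpa using ht
    · simpa [outcome] using ho

theorem lazy_acyclic {A O : Type} (prec : A → O → O → Prop) (hacyc : ∀ a : A, Acyclic (prec a)) :
    Acyclic (Lazy (A := A) (O := O) prec) := by
  classical
  intro s hs
  obtain ⟨t, ⟨q, hst, hpr⟩, hts⟩ := Relation.TransGen.head'_iff.1 hs
  let f : O → ℤ := fun o => if Relation.ReflTransGen (prec q) t.outcome o then 1 else 0
  have mono : ∀ x y : Profile A O, Lazy prec x y → pot q f x ≤ pot q f y := by
    rintro x y ⟨a, hc, hp⟩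
    have h := pot_step q f a hc
    by_cases ha : a = q
    · subst ha
      have : f x.outcome ≤ f y.outcome := by
        by_cases hx : Relation.ReflTransGen (prec a) t.outcome x.outcome
        · have hy := hx.tail hp
          simp [f, hx, hy]
        · simp only [f, hx, if_false]
          split_ifs <;> simp
      simp only [if_true] at h
      linarith
    · simp only [ha, if_false] at h
      linarith
  have h1 : pot q f t ≤ pot q f s := by
    clear hs hst hpr
    revert hts
    generalize ht : t = u
    intro hts
    clear ht
    induction hts with
    | refl => exact le_rfl
    | tail _ h ih => exact ih.trans (mono _ _ h)
  have h2 := pot_step q f q hst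
  have f1 : f t.outcome = 1 := by simp [f, Relation.ReflTransGen.refl]
  have f0 : f s.outcome = 0 := by
    simp only [f]
    rw [if_neg]
    intro h
    exact hacyc q _ (Relation.TransGen.head' hpr h)
  simp only [if_true, f1, f0] at h2
  linarith

end Profile

open Profile in
/-- In a finite sequential game where every player has an acyclic preference relation,
lazy improvement is a semi-potential: `⇀` is acyclic, `⇀` is contained in the improvement
relation `↠`, and whenever `s ↠ s'` there is `s''` with `s ⇀ s''` and `v(s') = v(s'')`. -/
theorem lazy_improvement_is_semipotential {A O : Type}
    (prec : A → O → O → Prop) (hacyc : ∀ a : A, Acyclic (prec a)) :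
    Acyclic (Lazy (A := A) (O := O) prec)
    ∧ (∀ s s' : Profile A O, Lazy prec s s' → Improve prec s s')
    ∧ (∀ s s' : Profile A O, Improve prec s s' →
        ∃ s'' : Profile A O, Lazy prec s s'' ∧ outcome s'' = outcome s') := by
  refine ⟨lazy_acyclic prec hacyc, ?_, ?_⟩
  · rintro s s' ⟨a, hc, hp⟩
    exact ⟨a, hc.conv, hp⟩
  · rintro s s' ⟨a, hc, hp⟩
    obtain ⟨s'', h, ho⟩ := hc.lazify
    exact ⟨s'', ⟨a, h, by rw [ho]; exact hp⟩, ho⟩
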